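/- Let ω = v_0 v_0 v_0 ⋯ be a periodic infinite word with v_0 ∈ F_n^+ primitive, and let T = (T_1,…,T_n) be a bilateral weighted shift on K_ω with bounded weights Λ = {λ_u}_{u∈F_ω} satisfying λ_u > 0 for all u. Then the family {T_1,…,T_n} has a non-trivial joint reducing subspace if and only if the weights Λ are periodic, i.e., there exists an integer k ≥ 1 such that λ_{u v_0^k} = λ_u for every u ∈ F_ω. -/

import Mathlib

open scoped ENNReal InnerProductSpace

noncomputable section

variable {n : ℕ}

/-- The element of the free group determined by a word (list of generators). -/
def wordProd (l : List (Fin n)) : FreeGroup (Fin n) := (l.map FreeGroup.of).prod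

/-- The initial segment `ω_m = i_1 i_2 ⋯ i_m` of an infinite word `ω`. -/
def initSeg (ω : ℕ → Fin n) (m : ℕ) : List (Fin n) := List.ofFn fun j : Fin m => ω j

/-- The set `F_ω = { v ω_m⁻¹ : v ∈ F_n^+, m ≥ 0 }` inside the free group. -/
def Fomega (ω : ℕ → Fin n) : Set (FreeGroup (Fin n)) :=
  {g | ∃ (v : List (Fin n)) (m : ℕ), g = wordProd v * (wordProd (initSeg ω m))⁻¹}

lemma genMul_mem (ω : ℕ → Fin n) (i : Fin n) {g : FreeGroup (Fin n)} (hg : g ∈ Fomega ω) :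
    FreeGroup.of i * g ∈ Fomega ω := by
  obtain ⟨v, m, rfl⟩ := hg
  exact ⟨i :: v, m, by simp [wordProd, mul_assoc]⟩

/-- `K_ω = ℓ²(F_ω)`. -/
abbrev Komega (ω : ℕ → Fin n) : Type _ := lp (fun _ : Fomega ω => ℂ) 2

/-- The standard orthonormal basis vector `ξ_u` of `K_ω`. -/
def xi (ω : ℕ → Fin n) (u : Fomega ω) : Komega ω := lp.single 2 u 1

/-- `iu` as an element of `F_ω`. -/
def gen (ω : ℕ → Fin n) (i : Fin n) (u : Fomega ω) : Fomega ω :=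
  ⟨FreeGroup.of i * u.1, genMul_mem ω i u.2⟩

/-- `T = (T_1,…,T_n)` is the bilateral weighted shift on `K_ω` with (complex) weights `Λ`:
`T_i ξ_u = λ_{iu} ξ_{iu}`. -/
def IsWeightedShift (ω : ℕ → Fin n) (Λ : Fomega ω → ℂ)
    (T : Fin n → Komega ω →L[ℂ] Komega ω) : Prop :=
  ∀ (i : Fin n) (u : Fomega ω), T i (xi ω u) = Λ (gen ω i u) • xi ω (gen ω i u)

/-- real-weight version -/
def IsWeightedShiftR (ω : ℕ → Fin n) (Λ : Fomega ω → ℝ)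
    (T : Fin n → Komega ω →L[ℂ] Komega ω) : Prop :=
  ∀ (i : Fin n) (u : Fomega ω), T i (xi ω u) = (Λ (gen ω i u) : ℂ) • xi ω (gen ω i u)

/-- A closed subspace `H` is reducing for an operator `A` if `H` and `Hᗮ` are `A`-invariant. -/
def Reduces {E : Type*} [NormedAddCommGroup E] [InnerProductSpace ℂ E]
    (A : E →L[ℂ] E) (H : Submodule ℂ E) : Prop :=
  (∀ x ∈ H, A x ∈ H) ∧ ∀ x ∈ Hᗮ, A x ∈ Hᗮ

/-- `w^k` for a finite word `w`. -/
def listPow (w : List (Fin n)) : ℕ → List (Fin n)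
  | 0 => []
  | k + 1 => w ++ listPow w k

/-- A word is primitive if it is non-empty and not a proper power. -/
def Primitive (v : List (Fin n)) : Prop :=
  v ≠ [] ∧ ∀ (w : List (Fin n)) (j : ℕ), 2 ≤ j → v ≠ listPow w j

/-- `ω = v v v ⋯`. -/
def IsPeriodicWord (ω : ℕ → Fin n) (v : List (Fin n)) : Prop :=
  v ≠ [] ∧ ∀ k : ℕ, initSeg ω (k * v.length) = listPow v k

/-- `ω = u v₀ v₀ v₀ ⋯` for some words `u, v₀` with `v₀` non-empty. -/
def EventuallyPeriodic (ω : ℕ → Fin n) : Prop :=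
  ∃ N p : ℕ, 1 ≤ p ∧ ∀ m ≥ N, ω (m + p) = ω m

def Aperiodic (ω : ℕ → Fin n) : Prop := ¬EventuallyPeriodic ω

section Words

lemma wordProd_cons (i : Fin n) (l : List (Fin n)) :
    wordProd (i :: l) = FreeGroup.of i * wordProd l := by
  simp [wordProd]

lemma wordProd_append (l l' : List (Fin n)) :
    wordProd (l ++ l') = wordProd l * wordProd l' := by
  simp [wordProd]

lemma wordProd_listPow (w : List (Fin n)) (k : ℕ) :
    wordProd (listPow w k) = wordProd w ^ k := by
  induction k with
  | zero => simp [listPow, wordProd]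
  | succ k ih => rw [listPow, wordProd_append, ih, pow_succ']

lemma wordProd_eq_mk (l : List (Fin n)) :
    wordProd l = FreeGroup.mk (l.map fun i => (i, true)) := by
  induction l with
  | nil => rfl
  | cons i l ih => rw [wordProd_cons, ih]; rfl

lemma wordProd_injective : Function.Injective (wordProd : List (Fin n) → FreeGroup (Fin n)) := by
  have toWord_wordProd (l : List (Fin n)) :
      (wordProd l).toWord = l.map fun i => (i, true) := by
    rw [wordProd_eq_mk, FreeGroup.toWord_mk]
    apply FreeGroup.IsReduced.reduce_eq
    rw [FreeGroup.IsReduced, List.isChain_map]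
    induction l with
    | nil => simp
    | cons i l ih => cases l <;> simp_all
  intro l l' h
  have h' := toWord_wordProd l
  rw [h, toWord_wordProd l'] at h'
  exact (List.map_injective_iff.2 (fun a b hab => (Prod.ext_iff.1 hab).1) h').symm

lemma initSeg_succ (ω : ℕ → Fin n) (m : ℕ) : initSeg ω (m + 1) = initSeg ω m ++ [ω m] := by
  rw [initSeg, List.ofFn_succ', List.concat_eq_append]
  rfl

/-- The element `ω_m⁻¹` of `F_ω`. -/
def tail (ω : ℕ → Fin n) (m : ℕ) : Fomega ω :=
  ⟨(wordProd (initSeg ω m))⁻¹, [], m, by simp [wordProd]⟩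

lemma coe_tail (ω : ℕ → Fin n) (m : ℕ) : (tail ω m).1 = (wordProd (initSeg ω m))⁻¹ := rfl

lemma coe_gen (ω : ℕ → Fin n) (i : Fin n) (u : Fomega ω) :
    (gen ω i u).1 = FreeGroup.of i * u.1 := rfl

lemma tail_eq_gen (ω : ℕ → Fin n) (m : ℕ) : tail ω m = gen ω (ω m) (tail ω (m + 1)) := by
  apply Subtype.ext
  rw [coe_gen, coe_tail, coe_tail, initSeg_succ, wordProd_append]
  simp [wordProd]

lemma coe_foldr_gen (ω : ℕ → Fin n) (w : List (Fin n)) (u : Fomega ω) :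
    (w.foldr (gen ω) u).1 = wordProd w * u.1 := by
  induction w with
  | nil => simp [wordProd]
  | cons i w ih => rw [List.foldr_cons, coe_gen, ih, wordProd_cons, mul_assoc]

lemma exists_eq_foldr_tail {ω : ℕ → Fin n} (u : Fomega ω) :
    ∃ r L : ℕ, ∀ j, ∃ w : List (Fin n), w.length = L + j ∧ u = w.foldr (gen ω) (tail ω (r + j)) := by
  obtain ⟨_, v, m, rfl⟩ := u
  refine ⟨m, v.length, fun j => ?_⟩
  induction j with
  | zero => exact ⟨v, rfl, Subtype.ext (by rw [coe_foldr_gen]; rfl)⟩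
  | succ j ih =>
    obtain ⟨w, hw, h⟩ := ih
    refine ⟨w ++ [ω (m + j)], by simp [hw]; ring, ?_⟩
    rw [h, tail_eq_gen, List.foldr_append]
    rfl

lemma exists_eq_foldr_tail_of_le {ω : ℕ → Fin n} (u : Fomega ω) :
    ∃ r : ℕ, ∀ N ≥ r, ∃ w : List (Fin n), u = w.foldr (gen ω) (tail ω N) := by
  obtain ⟨r, L, h⟩ := exists_eq_foldr_tail u
  refine ⟨r, fun N hN => ?_⟩
  obtain ⟨w, -, hw⟩ := h (N - r)
  exact ⟨w, by rw [hw, Nat.add_sub_cancel' hN]⟩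

lemma exists_eq_gen {ω : ℕ → Fin n} (u : Fomega ω) : ∃ i v, u = gen ω i v := by
  obtain ⟨r, h⟩ := exists_eq_foldr_tail_of_le u
  obtain ⟨w, rfl⟩ := h r le_rfl
  cases w with
  | nil => exact ⟨_, _, tail_eq_gen ω r⟩
  | cons i w => exact ⟨i, _, rfl⟩

lemma gen_injective (ω : ℕ → Fin n) (i : Fin n) : Function.Injective (gen ω i) := by
  intro u v h
  exact Subtype.ext (mul_left_cancel (Subtype.ext_iff.1 h))

lemma eq_of_gen_eq_gen {ω : ℕ → Fin n} {i j : Fin n} {u v : Fomega ω}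
    (h : gen ω i u = gen ω j v) : i = j := by
  obtain ⟨r, hr⟩ := exists_eq_foldr_tail_of_le u
  obtain ⟨s, hs⟩ := exists_eq_foldr_tail_of_le v
  obtain ⟨w, rfl⟩ := hr (max r s) (le_max_left _ _)
  obtain ⟨z, rfl⟩ := hs (max r s) (le_max_right _ _)
  have h' := congrArg Subtype.val h
  simp only [gen, coe_foldr_gen, ← mul_assoc, ← wordProd_cons, mul_left_inj] at h'
  exact (List.cons.inj (wordProd_injective h')).1

lemma wordProd_initSeg_mul_length {ω : ℕ → Fin n} {v : List (Fin n)} (h : IsPeriodicWord ω v)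
    (l : ℕ) : wordProd (initSeg ω (l * v.length)) = wordProd v ^ l := by
  rw [h.2, wordProd_listPow]

lemma wordProd_pow_ne_one {v : List (Fin n)} (hv : v ≠ []) {k : ℕ} (hk : 1 ≤ k) :
    wordProd v ^ k ≠ 1 := by
  rw [← wordProd_listPow]
  intro h
  have h' : listPow v k = [] := wordProd_injective (h.trans (by simp [wordProd]))
  obtain ⟨k, rfl⟩ := Nat.exists_eq_add_of_le' hk
  simp [listPow, hv] at h'

/-- Right translation by `v ^ k` preserves `F_ω` if `ω = v v v ⋯`, for all integers `k`. -/
lemma mul_zpow_mem {ω : ℕ → Fin n} {v : List (Fin n)} (h : IsPeriodicWord ω v)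
    {g : FreeGroup (Fin n)} (hg : g ∈ Fomega ω) (k : ℤ) : g * wordProd v ^ k ∈ Fomega ω := by
  have hlen : 1 ≤ v.length := List.length_pos_iff.2 h.1
  obtain ⟨r, hr⟩ := exists_eq_foldr_tail_of_le ⟨g, hg⟩
  obtain ⟨w, hw⟩ := hr ((r + k.natAbs) * v.length)
    ((Nat.le_add_right _ _).trans (Nat.le_mul_of_pos_right _ hlen))
  have hw' := congrArg Subtype.val hw
  rw [coe_foldr_gen, coe_tail, wordProd_initSeg_mul_length h] at hw'
  have key : g * wordProd v ^ k = wordProd w * (wordProd v ^ ((r + k.natAbs : ℤ) - k).toNat)⁻¹ := by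
    simp only at hw'
    rw [hw', mul_assoc, ← zpow_natCast, ← zpow_natCast, ← zpow_neg, ← zpow_neg, ← zpow_add]
    congr 2
    omega
  rw [key, ← wordProd_initSeg_mul_length h]
  exact ⟨_, _, rfl⟩

/-- An equivariant symmetric relation off the diagonal that preserves weights forces the weights to
be periodic. -/
lemma weights_periodic_of_relation {ω : ℕ → Fin n} {v : List (Fin n)} (h : IsPeriodicWord ω v)
    {Λ : Fomega ω → ℝ} {R : Fomega ω → Fomega ω → Prop} (hsymm : ∀ u u', R u u' → R u' u)
    (hgen : ∀ i u u', R (gen ω i u) (gen ω i u') ↔ R u u')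
    (hrange : ∀ i u x, R (gen ω i u) x → ∃ u', x = gen ω i u')
    (hΛ : ∀ i u u', R (gen ω i u) (gen ω i u') → Λ (gen ω i u) = Λ (gen ω i u'))
    {u u' : Fomega ω} (hR : R u u') (hne : u ≠ u') :
    ∃ k : ℕ, 1 ≤ k ∧ ∀ (u : Fomega ω) (h : u.1 * wordProd (listPow v k) ∈ Fomega ω),
      Λ ⟨u.1 * wordProd (listPow v k), h⟩ = Λ u := by
  have hlen : 1 ≤ v.length := List.length_pos_iff.2 h.1
  have weight_eq {x y : Fomega ω} (hxy : R x y) : Λ x = Λ y := by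
    obtain ⟨i, x, rfl⟩ := exists_eq_gen x
    obtain ⟨y, rfl⟩ := hrange _ _ _ hxy
    exact hΛ _ _ _ hxy
  have foldr_iff (w : List (Fin n)) (x y : Fomega ω) :
      R (w.foldr (gen ω) x) (w.foldr (gen ω) y) ↔ R x y := by
    induction w with
    | nil => rfl
    | cons i w ih => rw [List.foldr_cons, List.foldr_cons, hgen, ih]
  have word_eq (w w' : List (Fin n)) (x y : Fomega ω) (hl : w.length = w'.length)
      (hw : R (w.foldr (gen ω) x) (w'.foldr (gen ω) y)) : w = w' := by
    induction w generalizing w' with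
    | nil => exact (List.length_eq_zero_iff.1 hl.symm).symm
    | cons i w ih =>
      obtain _ | ⟨j, w'⟩ := w'
      · simp at hl
      obtain ⟨z, hz⟩ := hrange _ _ _ hw
      obtain rfl : j = i := eq_of_gen_eq_gen hz
      rw [ih w' (by simpa using hl) ((hgen _ _ _).1 hw)]
  obtain ⟨a, b, hab, hRab⟩ : ∃ a b, a < b ∧ R (tail ω a) (tail ω b) := by
    obtain ⟨r, L, hr⟩ := exists_eq_foldr_tail u
    obtain ⟨r', L', hr'⟩ := exists_eq_foldr_tail u'
    obtain ⟨w, hw, hu⟩ := hr L'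
    obtain ⟨w', hw', hu'⟩ := hr' L
    rw [hu, hu'] at hR
    obtain rfl := word_eq w w' _ _ (by omega) hR
    rw [foldr_iff] at hR
    rcases lt_trichotomy (r + L') (r' + L) with hlt | heq | hlt
    · exact ⟨_, _, hlt, hR⟩
    · exact absurd (by rw [hu, hu', heq]) hne
    · exact ⟨_, _, hlt, hsymm _ _ hR⟩
  obtain ⟨p, rfl⟩ := Nat.exists_eq_add_of_lt hab
  have tail_shift (j : ℕ) : R (tail ω (a + j)) (tail ω (a + j + (p + 1))) := by
    induction j with
    | zero => exact hRab
    | succ j ih =>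
      rw [tail_eq_gen ω (a + j), tail_eq_gen ω (a + j + (p + 1))] at ih
      obtain ⟨z, hz⟩ := hrange _ _ _ ih
      rw [eq_of_gen_eq_gen hz, hgen] at ih
      convert ih using 2 <;> omega
  have shift_weights (w : List (Fin n)) (c : ℕ) (hc : a ≤ c) (t : ℕ) :
      Λ (w.foldr (gen ω) (tail ω c)) = Λ (w.foldr (gen ω) (tail ω (c + t * (p + 1)))) := by
    induction t with
    | zero => simp
    | succ t ih =>
      obtain ⟨j, hj⟩ := Nat.exists_eq_add_of_le (hc.trans (Nat.le_add_right c (t * (p + 1))))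
      rw [ih, hj, weight_eq ((foldr_iff w _ _).2 (tail_shift j)), ← hj]
      congr 3
      ring
  refine ⟨p + 1, by omega, fun x hx => ?_⟩
  obtain ⟨r, hr⟩ := exists_eq_foldr_tail_of_le ⟨_, hx⟩
  obtain ⟨w, hw⟩ := hr ((r + a) * v.length) (by nlinarith)
  have hx' : x = w.foldr (gen ω) (tail ω ((r + a) * v.length + v.length * (p + 1))) := by
    apply Subtype.ext
    have hw' : x.1 * wordProd (listPow v (p + 1)) = _ := congrArg Subtype.val hw
    rw [coe_foldr_gen, coe_tail, wordProd_initSeg_mul_length h, wordProd_listPow] at hw'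
    rw [coe_foldr_gen, coe_tail, mul_comm v.length, ← add_mul, wordProd_initSeg_mul_length h,
      add_comm (r + a), pow_add, mul_inv_rev, ← mul_assoc]
    exact eq_mul_inv_of_mul_eq hw'
  rw [hw, shift_weights w _ (by nlinarith) v.length, ← hx']

end Words

section Operators

lemma xi_apply (ω : ℕ → Fin n) (u x : Fomega ω) : (xi ω u) x = if x = u then 1 else 0 := by
  rw [xi, lp.single_apply, Pi.single_apply]

lemma inner_xi_left (ω : ℕ → Fin n) (u : Fomega ω) (f : Komega ω) : ⟪xi ω u, f⟫_ℂ = f u := by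
  rw [xi, lp.inner_single_left]
  simp

lemma adjoint_apply_coord {ω : ℕ → Fin n} {Λ : Fomega ω → ℝ}
    {T : Fin n → Komega ω →L[ℂ] Komega ω} (hT : IsWeightedShiftR ω Λ T) (i : Fin n)
    (f : Komega ω) (u : Fomega ω) :
    (star (T i) f) u = Λ (gen ω i u) * f (gen ω i u) := by
  rw [← inner_xi_left, ContinuousLinearMap.star_eq_adjoint,
    ContinuousLinearMap.adjoint_inner_right, hT, inner_smul_left, inner_xi_left]
  simp

lemma adjoint_xi_gen {ω : ℕ → Fin n} {Λ : Fomega ω → ℝ}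
    {T : Fin n → Komega ω →L[ℂ] Komega ω} (hT : IsWeightedShiftR ω Λ T) (i : Fin n)
    (u : Fomega ω) : star (T i) (xi ω (gen ω i u)) = (Λ (gen ω i u) : ℂ) • xi ω u := by
  ext x
  rw [adjoint_apply_coord hT, lp.coeFn_smul, Pi.smul_apply, xi_apply, xi_apply, smul_eq_mul]
  by_cases h : x = u
  · simp [h]
  · simp [h, (gen_injective ω i).ne h]

lemma adjoint_xi_eq_zero {ω : ℕ → Fin n} {Λ : Fomega ω → ℝ}
    {T : Fin n → Komega ω →L[ℂ] Komega ω} (hT : IsWeightedShiftR ω Λ T) {i : Fin n}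
    {x : Fomega ω} (hx : ∀ u, x ≠ gen ω i u) : star (T i) (xi ω x) = 0 := by
  ext u
  rw [adjoint_apply_coord hT, xi_apply, if_neg (hx u).symm]
  simp

/-- A self-adjoint operator commuting with the adjoints of a weighted shift, for which the weights
are not periodic, is scalar. -/
lemma eq_smul_one_of_commute {ω : ℕ → Fin n} {v : List (Fin n)} (h : IsPeriodicWord ω v)
    {Λ : Fomega ω → ℝ} (hpos : ∀ u, 0 < Λ u) {T : Fin n → Komega ω →L[ℂ] Komega ω}
    (hT : IsWeightedShiftR ω Λ T)
    (hΛ : ¬ ∃ k : ℕ, 1 ≤ k ∧ ∀ (u : Fomega ω) (h : u.1 * wordProd (listPow v k) ∈ Fomega ω),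
      Λ ⟨u.1 * wordProd (listPow v k), h⟩ = Λ u)
    {P : Komega ω →L[ℂ] Komega ω} (hP : IsSelfAdjoint P) (hc : ∀ i, Commute P (star (T i))) :
    ∃ c : ℂ, P = c • 1 := by
  have hpos' (u) : (Λ u : ℂ) ≠ 0 := by exact_mod_cast (hpos u).ne'
  have hsym (u u') : P (xi ω u') u = star (P (xi ω u) u') := by
    rw [← inner_xi_left, ← inner_xi_left, ← ContinuousLinearMap.adjoint_inner_left,
      ← ContinuousLinearMap.star_eq_adjoint, hP.star_eq]
    exact (inner_conj_symm _ _).symm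
  have hcomm (i u u') : (Λ (gen ω i u) : ℂ) * P (xi ω (gen ω i u')) (gen ω i u)
      = Λ (gen ω i u') * P (xi ω u') u := by
    rw [← adjoint_apply_coord hT]
    have := congrArg (fun A : Komega ω →L[ℂ] Komega ω => A (xi ω (gen ω i u')) u) (hc i).eq
    simp only [mul_apply_eq_comp, adjoint_xi_gen hT, map_smul] at this
    rw [← this]
    rfl
  have hcomm' (i u u') : (Λ (gen ω i u') : ℂ) * P (xi ω (gen ω i u')) (gen ω i u)
      = Λ (gen ω i u) * P (xi ω u') u := by
    have := congrArg star (hcomm i u' u)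
    rw [star_mul', star_mul', ← hsym, ← hsym] at this
    simpa using this
  have hweights (i u u') (hne : P (xi ω (gen ω i u')) (gen ω i u) ≠ 0) :
      Λ (gen ω i u) = Λ (gen ω i u') := by
    have hsq : (Λ (gen ω i u) : ℂ) ^ 2 = (Λ (gen ω i u') : ℂ) ^ 2 := by
      apply mul_right_cancel₀ hne
      linear_combination (Λ (gen ω i u) : ℂ) * hcomm i u u' - Λ (gen ω i u') * hcomm' i u u'
    exact (pow_left_inj₀ (hpos _).le (hpos _).le two_ne_zero).1 (by exact_mod_cast hsq)
  have hdiag (u u') (hne : u ≠ u') : P (xi ω u') u = 0 := by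
    by_contra hR
    refine hΛ (weights_periodic_of_relation h (R := fun u u' => P (xi ω u') u ≠ 0)
      ?_ ?_ ?_ hweights hR hne)
    · intro u u' hu
      rw [hsym]
      exact star_ne_zero.2 hu
    · intro i u u'
      refine not_congr ⟨fun h0 => ?_, fun h0 => ?_⟩
      · simpa [h0, hpos'] using hcomm i u u'
      · simpa [h0, hpos'] using hcomm i u u'
    · intro i u x hx
      by_contra! hn
      have := congrArg (fun A : Komega ω →L[ℂ] Komega ω => A (xi ω x) u) (hc i).eq
      simp only [mul_apply_eq_comp, adjoint_xi_eq_zero hT hn, map_zero,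
        adjoint_apply_coord hT] at this
      exact mul_ne_zero (hpos' _) hx this.symm
  have hgen (i u) : P (xi ω (gen ω i u)) (gen ω i u) = P (xi ω u) u :=
    mul_left_cancel₀ (hpos' _) (hcomm i u u)
  have hfoldr (w : List (Fin n)) (u) :
      P (xi ω (w.foldr (gen ω) u)) (w.foldr (gen ω) u) = P (xi ω u) u := by
    induction w with
    | nil => rfl
    | cons i w ih => rw [List.foldr_cons, hgen, ih]
  have htail (m : ℕ) : P (xi ω (tail ω m)) (tail ω m) = P (xi ω (tail ω 0)) (tail ω 0) := by
    induction m with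
    | zero => rfl
    | succ m ih => rw [← ih, tail_eq_gen ω m, hgen]
  have hconst (u) : P (xi ω u) u = P (xi ω (tail ω 0)) (tail ω 0) := by
    obtain ⟨r, hr⟩ := exists_eq_foldr_tail_of_le u
    obtain ⟨w, hw⟩ := hr r le_rfl
    rw [hw, hfoldr, htail]
  refine ⟨star (P (xi ω (tail ω 0)) (tail ω 0)), ?_⟩
  have hxi (u) : P (xi ω u) = P (xi ω (tail ω 0)) (tail ω 0) • xi ω u := by
    ext x
    rw [lp.coeFn_smul, Pi.smul_apply, xi_apply, ← hconst u]
    by_cases hx : x = u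
    · simp [hx]
    · simp [hx, hdiag x u hx]
  ext f u
  rw [← inner_xi_left, ← ContinuousLinearMap.adjoint_inner_left,
    ← ContinuousLinearMap.star_eq_adjoint, hP.star_eq, hxi, inner_smul_left, inner_xi_left]
  rfl

/-- The projection onto a reducing subspace commutes with the adjoint of the operator. -/
lemma commute_starProjection_star {E : Type*} [NormedAddCommGroup E] [InnerProductSpace ℂ E]
    [CompleteSpace E] {A : E →L[ℂ] E} {H : Submodule ℂ E} [H.HasOrthogonalProjection]
    (h : Reduces A H) : Commute H.starProjection (star A) := by
  have hA : Commute H.starProjection A := by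
    ext x
    simp only [mul_apply_eq_comp]
    have hx : A x = A (H.starProjection x) + A (x - H.starProjection x) := by
      rw [← map_add, add_sub_cancel]
    rw [hx, map_add,
      Submodule.starProjection_eq_self_iff.2 (h.1 _ (H.starProjection_apply_mem x)),
      (Submodule.starProjection_apply_eq_zero_iff H).2
        (h.2 _ (H.sub_starProjection_mem_orthogonal x)), add_zero]
  have := hA.star_star
  rwa [(isSelfAdjoint_starProjection H).star_eq] at this

/-- A family of operators has a non-trivial joint reducing subspace if some non-scalar normal
operator commutes, along with its adjoint, with every member of the family. -/
lemma exists_reducing_of_commute {E ι : Type*} [NormedAddCommGroup E] [InnerProductSpace ℂ E]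
    [CompleteSpace E] (A : ι → E →L[ℂ] E) (U : E →L[ℂ] E) [IsStarNormal U]
    (hU : ∀ c : ℂ, U ≠ algebraMap ℂ _ c) (hc : ∀ i, Commute U (A i))
    (hc' : ∀ i, Commute (star U) (A i)) :
    ∃ H : Submodule ℂ E, IsClosed (H : Set E) ∧ H ≠ ⊥ ∧ H ≠ ⊤ ∧ ∀ i, Reduces (A i) H := by
  have hnt : Nontrivial (E →L[ℂ] E) := ⟨U, _, hU 0⟩
  obtain ⟨a, ha⟩ := spectrum.nonempty U
  obtain ⟨b, hb, hab⟩ : ∃ b ∈ spectrum ℂ U, b ≠ a := by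
    by_contra! hn
    refine hU a ?_
    rw [← cfc_const a U, ← cfc_congr (f := id) (fun x hx => hn x hx), cfc_id ℂ U]
  let d := dist b a
  have hd : 0 < d := dist_pos.2 hab
  let bump (z x : ℂ) : ℂ := ((max 0 (d / 2 - dist x z) : ℝ) : ℂ)
  have hbump (z) : Continuous (bump z) := by fun_prop
  have hbump_self (z) : bump z z ≠ 0 := by
    simp only [bump, dist_self, sub_zero]
    rw [max_eq_right (by positivity)]
    exact_mod_cast (half_pos hd).ne'
  have hne (z) (hz : z ∈ spectrum ℂ U) : cfc (bump z) U ≠ 0 := by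
    intro h0
    have := cfc_zero ℂ U ▸ h0
    exact hbump_self z (((cfc_eq_cfc_iff_eqOn (hf := (hbump z).continuousOn)).1 this) hz)
  have hmul : cfc (bump a) U * cfc (bump b) U = 0 := by
    rw [← cfc_mul _ _ U (hbump a).continuousOn (hbump b).continuousOn, ← cfc_zero ℂ U]
    congr 1
    ext x
    simp only [bump, Pi.zero_apply, mul_eq_zero, Complex.ofReal_eq_zero, max_eq_left_iff]
    by_contra! hx
    have := dist_triangle_left b a x
    change d ≤ _ at this
    linarith
  set S := cfc (bump a) U with hS
  have hSA : star S = S := by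
    rw [hS, ← cfc_star]
    simp [bump]
  have hcS (i) : Commute S (A i) := Commute.cfc (hc i) (hc' i) _
  have hcS' (i) : Commute S (star (A i)) := by
    have := (hcS i).star_star
    rwa [hSA] at this
  refine ⟨LinearMap.ker S.toLinearMap, S.isClosed_ker, fun h => hne b hb ?_,
    fun h => hne a ha ?_, fun i => ⟨?_, ?_⟩⟩
  · ext x
    have : cfc (bump b) U x ∈ LinearMap.ker S.toLinearMap :=
      congrArg (fun B : E →L[ℂ] E => B x) hmul
    rwa [h, Submodule.mem_bot] at this
  · ext x
    have : x ∈ LinearMap.ker S.toLinearMap := h ▸ Submodule.mem_top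
    exact this
  · intro x hx
    have := congrArg (fun B : E →L[ℂ] E => B x) (hcS i).eq
    simp only [mul_apply_eq_comp] at this
    change S (A i x) = 0
    rw [this, show S x = 0 from hx, map_zero]
  · intro x hx
    rw [Submodule.mem_orthogonal] at hx ⊢
    intro y hy
    rw [← ContinuousLinearMap.adjoint_inner_left]
    apply hx
    have := congrArg (fun B : E →L[ℂ] E => B y) (hcS' i).eq
    simp only [mul_apply_eq_comp, ContinuousLinearMap.star_eq_adjoint] at this
    change S _ = 0
    rw [this, show S y = 0 from hy, map_zero]

/-- The unitary on `K_ω` that permutes the coordinates along `e`. -/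
lemma exists_permutation_unitary (ω : ℕ → Fin n) (e : Equiv.Perm (Fomega ω)) :
    ∃ U ∈ unitary (Komega ω →L[ℂ] Komega ω), ∀ f u, U f u = f (e u) := by
  have hon : Orthonormal ℂ fun u => xi ω (e u) := by
    classical
    rw [orthonormal_iff_ite]
    intro u u'
    rw [inner_xi_left, xi_apply]
    simp
  let b : HilbertBasis (Fomega ω) ℂ (Komega ω) := HilbertBasis.mkOfOrthogonalEqBot hon <| by
    rw [Submodule.eq_bot_iff]
    intro f hf
    ext u
    have := (Submodule.mem_orthogonal _ _).1 hf _ (Submodule.subset_span ⟨e.symm u, rfl⟩)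
    simpa [inner_xi_left] using this
  refine ⟨Unitary.linearIsometryEquiv.symm b.repr, Subtype.property _, fun f u => ?_⟩
  change b.repr f u = _
  rw [b.repr_apply_apply, HilbertBasis.coe_mkOfOrthogonalEqBot, inner_xi_left]

/-- Right translation by `v ^ k` as a permutation of `F_ω` for `ω = v v v ⋯`. -/
def mulRightPow {ω : ℕ → Fin n} {v : List (Fin n)} (h : IsPeriodicWord ω v) (k : ℕ) :
    Equiv.Perm (Fomega ω) where
  toFun u := ⟨u.1 * wordProd v ^ (k : ℤ), mul_zpow_mem h u.2 _⟩
  invFun u := ⟨u.1 * wordProd v ^ (-k : ℤ), mul_zpow_mem h u.2 _⟩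
  left_inv u := Subtype.ext (by simp)
  right_inv u := Subtype.ext (by simp)

lemma exists_reducing_of_weights_periodic {ω : ℕ → Fin n} {v : List (Fin n)}
    (h : IsPeriodicWord ω v) {Λ : Fomega ω → ℝ} {T : Fin n → Komega ω →L[ℂ] Komega ω}
    (hT : IsWeightedShiftR ω Λ T) {k : ℕ} (hk : 1 ≤ k)
    (hΛ : ∀ (u : Fomega ω) (h : u.1 * wordProd (listPow v k) ∈ Fomega ω),
      Λ ⟨u.1 * wordProd (listPow v k), h⟩ = Λ u) :
    ∃ H : Submodule ℂ (Komega ω), IsClosed (H : Set (Komega ω)) ∧ H ≠ ⊥ ∧ H ≠ ⊤ ∧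
      ∀ i : Fin n, Reduces (T i) H := by
  obtain ⟨U, hU, hUf⟩ := exists_permutation_unitary ω (mulRightPow h k)
  have hΛ' (u) : Λ (mulRightPow h k u) = Λ u := by
    rw [← hΛ u (by rw [wordProd_listPow]; exact_mod_cast mul_zpow_mem h u.2 k)]
    congr 1
    exact Subtype.ext (by simp [mulRightPow, wordProd_listPow])
  have hgen (i u) : gen ω i (mulRightPow h k u) = mulRightPow h k (gen ω i u) :=
    Subtype.ext (mul_assoc _ _ _).symm
  have hcomm (i) : Commute U (star (T i)) := by
    ext f u
    simp only [mul_apply_eq_comp]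
    rw [hUf, adjoint_apply_coord hT, adjoint_apply_coord hT, hUf, hgen, hΛ']
  have hcomm' (i) : Commute (star U) (star (T i)) := by
    have hl : star U * U = 1 := Unitary.star_mul_self_of_mem hU
    have hr : U * star U = 1 := Unitary.mul_star_self_of_mem hU
    calc star U * star (T i) = star U * (star (T i) * U) * star U := by
          rw [mul_assoc, mul_assoc, hr, mul_one]
      _ = star (T i) * star U := by rw [← (hcomm i).eq, ← mul_assoc, hl, one_mul]
  have : IsStarNormal U := ⟨(Unitary.star_mul_self_of_mem hU).trans
    (Unitary.mul_star_self_of_mem hU).symm⟩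
  refine exists_reducing_of_commute T U (fun c hc => ?_)
    (fun i => by simpa using (hcomm' i).star_star) (fun i => by simpa using (hcomm i).star_star)
  let x := (mulRightPow h k).symm (tail ω 0)
  have hx : x ≠ tail ω 0 := by
    intro hx
    rw [Equiv.symm_apply_eq] at hx
    have := congrArg Subtype.val hx
    simp only [mulRightPow, Equiv.coe_fn_mk, left_eq_mul, zpow_natCast] at this
    exact wordProd_pow_ne_one h.1 hk this
  have h1 : U (xi ω (tail ω 0)) x = 1 := by
    rw [hUf, xi_apply, Equiv.apply_symm_apply, if_pos rfl]
  rw [hc, Algebra.algebraMap_eq_smul_one] at h1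
  change c * (xi ω (tail ω 0)) x = 1 at h1
  rw [xi_apply, if_neg hx, mul_zero] at h1
  exact zero_ne_one h1

end Operators

/-- for a periodic word `ω = v₀v₀v₀⋯` (`v₀` primitive), a bilateral weighted
shift has a non-trivial joint reducing subspace iff the weights are periodic:
`λ_{u v₀^k} = λ_u` for some `k ≥ 1`. -/
theorem periodic_word_reducible_iff_weights_periodic
    {n : ℕ} (hn : 2 ≤ n) (ω : ℕ → Fin n) (v₀ : List (Fin n))
    (hv₀ : Primitive v₀) (hper : IsPeriodicWord ω v₀)
    (Λ : Fomega ω → ℝ) (hbdd : ∃ C : ℝ, ∀ u, ‖Λ u‖ ≤ C) (hpos : ∀ u, 0 < Λ u)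
    (T : Fin n → Komega ω →L[ℂ] Komega ω) (hT : IsWeightedShiftR ω Λ T) :
    (∃ H : Submodule ℂ (Komega ω), IsClosed (H : Set (Komega ω)) ∧ H ≠ ⊥ ∧ H ≠ ⊤ ∧
        ∀ i : Fin n, Reduces (T i) H) ↔
      (∃ k : ℕ, 1 ≤ k ∧ ∀ (u : Fomega ω)
        (h : u.1 * wordProd (listPow v₀ k) ∈ Fomega ω),
        Λ ⟨u.1 * wordProd (listPow v₀ k), h⟩ = Λ u) := by
  constructor
  · rintro ⟨H, hclosed, hbot, htop, hred⟩
    by_contra hΛ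
    have : CompleteSpace H := hclosed.completeSpace_coe
    obtain ⟨c, hc⟩ := eq_smul_one_of_commute hper hpos hT hΛ (isSelfAdjoint_starProjection H)
      fun i => commute_starProjection_star (hred i)
    by_cases hc0 : c = 0
    · refine hbot ((Submodule.eq_bot_iff H).2 fun x hx => ?_)
      rw [← Submodule.starProjection_eq_self_iff.2 hx, hc, hc0, zero_smul]
      rfl
    · refine htop ((Submodule.eq_top_iff').2 fun x => ?_)
      have hx := H.starProjection_apply_mem (c⁻¹ • x)
      rw [hc] at hx
      change c • c⁻¹ • x ∈ H at hx
      rwa [smul_inv_smul₀ hc0] at hx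
  · rintro ⟨k, hk, hΛ⟩
    exact exists_reducing_of_weights_periodic hper hT hk hΛ
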